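/- Let z₂ = (1/12)(−3+√33 − i√(102+6√33)) and let z̄₂ = (1/12)(−3+√33 + i√(102+6√33)) be its complex conjugate. For every integer n, the real numbers k = −4i·Log(z₂) + 8πn and k = −4i·Log(z̄₂) + 8πn satisfy D(k) = 0, where Log is the principal complex logarithm. -/

import Mathlib

/-- The edge scattering matrix of the lollipop graph of total length 1
(four edges of length 1/4). -/
noncomputable def Se (k : ℝ) : Matrix (Fin 8) (Fin 8) ℂ :=
  let e : ℂ := Complex.exp (Complex.I * k / 4)
  !![0, e, 0, 0, 0, 0, 0, 0;
     e, 0, 0, 0, 0, 0, 0, 0;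
     0, 0, 0, e, 0, 0, 0, 0;
     0, 0, e, 0, 0, 0, 0, 0;
     0, 0, 0, 0, 0, e, 0, 0;
     0, 0, 0, 0, e, 0, 0, 0;
     0, 0, 0, 0, 0, 0, 0, e;
     0, 0, 0, 0, 0, 0, e, 0]

/-- The vertex scattering matrix of the lollipop graph. -/
noncomputable def Sv : Matrix (Fin 8) (Fin 8) ℂ :=
  !![-1/3, 0, 0, 0, 0, 2/3, 2/3, 0;
     0, 0, 1, 0, 0, 0, 0, 0;
     0, 1, 0, 0, 0, 0, 0, 0;
     0, 0, 0, 0, 1, 0, 0, 0;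
     0, 0, 0, 1, 0, 0, 0, 0;
     2/3, 0, 0, 0, 0, -1/3, 2/3, 0;
     2/3, 0, 0, 0, 0, 2/3, -1/3, 0;
     0, 0, 0, 0, 0, 0, 0, 1]

/-- The secular function of the lollipop graph. -/
noncomputable def D (k : ℝ) : ℂ := (Se k * Sv - 1).det

noncomputable def z₂ : ℂ :=
  (1/12) * (-3 + (Real.sqrt 33 : ℂ) - Complex.I * (Real.sqrt (102 + 6 * Real.sqrt 33) : ℂ))

noncomputable def z₂conj : ℂ :=
  (1/12) * (-3 + (Real.sqrt 33 : ℂ) + Complex.I * (Real.sqrt (102 + 6 * Real.sqrt 33) : ℂ))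

/-- If `z = exp (ik/4)` is a root of `3z⁴ + 3z³ + 4z² + 3z + 3`, then `Se k * Sv` has eigenvalue `1`,
with an eigenvector that is symmetric along the cycle. -/
theorem D_eq_zero_of_quartic {k : ℝ} {z : ℂ} (hz : Complex.exp (Complex.I * k / 4) = z)
    (h : 3 * z ^ 4 + 3 * z ^ 3 + 4 * z ^ 2 + 3 * z + 3 = 0) : D k = 0 := by
  have hz0 : z ≠ 0 := hz ▸ Complex.exp_ne_zero _
  refine Matrix.exists_mulVec_eq_zero_iff.mp ⟨![z ^ 2 * (3 + z ^ 2), 3 + z ^ 2, z * (3 + z ^ 2),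
    z * (3 + z ^ 2), 3 + z ^ 2, z ^ 2 * (3 + z ^ 2), 4 * z ^ 4, 4 * z ^ 3], fun hv ↦ ?_, ?_⟩
  · have h6 := congrFun hv 6
    simp [hz0] at h6
  · rw [Matrix.sub_mulVec, Matrix.one_mulVec, ← Matrix.mulVec_mulVec, sub_eq_zero]
    ext i
    fin_cases i <;> simp [Se, Sv, hz, Matrix.mulVec, dotProduct, Fin.sum_univ_succ] <;>
      first | ring1 | linear_combination (z - 1) * h

theorem exp_eq_of_eq_log {k : ℝ} {z : ℂ} {n : ℤ} (hz : z ≠ 0)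
    (hk : (k : ℂ) = -4 * Complex.I * Complex.log z + 8 * Real.pi * n) :
    Complex.exp (Complex.I * k / 4) = z := by
  have : Complex.I * k / 4 = Complex.log z + n * (2 * Real.pi * Complex.I) := by
    rw [hk]
    linear_combination (-Complex.log z) * Complex.I_sq
  rw [this, Complex.exp_add, Complex.exp_int_mul_two_pi_mul_I, mul_one, Complex.exp_log hz]

theorem D_eq_zero_of_eq_log {k : ℝ} {z : ℂ} {n : ℤ}
    (h : 3 * z ^ 4 + 3 * z ^ 3 + 4 * z ^ 2 + 3 * z + 3 = 0)
    (hk : (k : ℂ) = -4 * Complex.I * Complex.log z + 8 * Real.pi * n) : D k = 0 := by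
  refine D_eq_zero_of_quartic (exp_eq_of_eq_log ?_ hk) h
  rintro rfl
  norm_num at h

/-- The complex numbers of the form `(-3 + s ± i√(102 + 6s)) / 12` with `s² = 33` are roots of the
quartic factor of the secular function. -/
theorem quartic_eq_zero {s t z : ℂ} (hs : s ^ 2 = 33) (ht : t ^ 2 = -(102 + 6 * s))
    (hz : z = (1 / 12) * (-3 + s + t)) :
    3 * z ^ 4 + 3 * z ^ 3 + 4 * z ^ 2 + 3 * z + 3 = 0 := by
  have h₁ : z ^ 2 - (s - 3) / 6 * z + 1 = 0 := by
    rw [hz]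
    linear_combination ht / 144 - hs / 144
  linear_combination (3 * z ^ 2 + (s + 3) / 2 * z + 3) * h₁ + z ^ 2 / 12 * hs

theorem lollipop_secular_zero_z₂_family (n : ℤ) (k k' : ℝ)
    (hk : (k : ℂ) = -4 * Complex.I * Complex.log z₂ + 8 * Real.pi * n)
    (hk' : (k' : ℂ) = -4 * Complex.I * Complex.log z₂conj + 8 * Real.pi * n) :
    D k = 0 ∧ D k' = 0 := by
  have hs : (Real.sqrt 33 : ℂ) ^ 2 = 33 := by
    exact_mod_cast Real.sq_sqrt (show (0 : ℝ) ≤ 33 by norm_num)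
  have ht : (Real.sqrt (102 + 6 * Real.sqrt 33) : ℂ) ^ 2 = 102 + 6 * (Real.sqrt 33 : ℂ) := by
    exact_mod_cast Real.sq_sqrt (show (0 : ℝ) ≤ 102 + 6 * Real.sqrt 33 by positivity)
  constructor
  · refine D_eq_zero_of_eq_log (quartic_eq_zero hs
      (t := -(Complex.I * (Real.sqrt (102 + 6 * Real.sqrt 33) : ℂ))) ?_ ?_) hk
    · rw [neg_sq, mul_pow, Complex.I_sq, ht, neg_one_mul]
    · rw [z₂, sub_eq_add_neg]
  · refine D_eq_zero_of_eq_log (quartic_eq_zero hs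
      (t := Complex.I * (Real.sqrt (102 + 6 * Real.sqrt 33) : ℂ)) ?_ z₂conj.eq_def) hk'
    rw [mul_pow, Complex.I_sq, ht, neg_one_mul]
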